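/- For every PDL_REwLA+ formula φ: φ is valid on GRELfinlin (i.e., ⟦φ⟧ˢ = W for every generalized structure S whose universal relation is a finite linear order) if and only if φ is derivable in the Hilbert system H for PDL_REwLA+. -/

import Mathlib

/-! Statement 4 (Main theorem): soundness and completeness of the Hilbert system `H`
for PDL_REwLA+ with respect to GRELfinlin. -/

/-- A generalized structure over term variables `A` and formula variables `P`,
with universe `W`. -/
structure GStruct (A P W : Type) where
  U : W → W → Prop
  rel : A → W → W → Prop
  rel_sub : ∀ a x y, rel a x y → U x y
  val : P → W → Prop

/-- The universal relation is a finite linear order (on a nonempty finite universe). -/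
def FinLin {A P W : Type} (S : GStruct A P W) : Prop :=
  Nonempty W ∧ Finite W ∧ (∀ x, S.U x x) ∧
    (∀ x y z, S.U x y → S.U y z → S.U x z) ∧
    (∀ x y, S.U x y → S.U y x → x = y) ∧ (∀ x y, S.U x y ∨ S.U y x)

/-- The universal relation is a finite strict linear order
(on a nonempty finite universe). -/
def SFinLin {A P W : Type} (S : GStruct A P W) : Prop :=
  Nonempty W ∧ Finite W ∧ (∀ x, ¬ S.U x x) ∧
    (∀ x y z, S.U x y → S.U y z → S.U x z) ∧
    (∀ x y, x ≠ y → S.U x y ∨ S.U y x)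
mutual
  /-- Formulas of PDL for REwLA+. -/
  inductive Fml (A P : Type) : Type where
    | pv : P → Fml A P
    | imp : Fml A P → Fml A P → Fml A P
    | fls : Fml A P
    | box : Trm A P → Fml A P → Fml A P
  /-- Terms of PDL for REwLA+. -/
  inductive Trm (A P : Type) : Type where
    | tv : A → Trm A P
    | comp : Trm A P → Trm A P → Trm A P
    | union : Trm A P → Trm A P → Trm A P
    | plus : Trm A P → Trm A P
    | adom : Trm A P → Trm A P
    | capId : Trm A P → Trm A P
    | capNid : Trm A P → Trm A P
    | test : Fml A P → Trm A P
end

namespace Fml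
/-- ¬φ := φ → F -/
def neg {A P : Type} (φ : Fml A P) : Fml A P := .imp φ .fls
/-- T := ¬F -/
def tru {A P : Type} : Fml A P := neg .fls
/-- φ ∨ ψ := ¬φ → ψ -/
def or {A P : Type} (φ ψ : Fml A P) : Fml A P := .imp (neg φ) ψ
/-- φ ∧ ψ := ¬(¬φ ∨ ¬ψ) -/
def and {A P : Type} (φ ψ : Fml A P) : Fml A P := neg (or (neg φ) (neg ψ))
/-- φ ↔ ψ := (φ → ψ) ∧ (ψ → φ) -/
def iff {A P : Type} (φ ψ : Fml A P) : Fml A P := and (.imp φ ψ) (.imp ψ φ)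
/-- ⟨e⟩φ := ¬[e]¬φ -/
def dia {A P : Type} (e : Trm A P) (φ : Fml A P) : Fml A P := neg (.box e (neg φ))
end Fml

mutual
  /-- Semantics of PDL_REwLA+ formulas on a generalized structure. -/
  def semF {A P W : Type} (S : GStruct A P W) : Fml A P → W → Prop
    | .pv p, x => S.val p x
    | .imp φ ψ, x => semF S φ x → semF S ψ x
    | .fls, _ => False
    | .box e φ, x => ∀ y, semT S e x y → semF S φ y
  /-- Semantics of PDL_REwLA+ terms on a generalized structure. -/
  def semT {A P W : Type} (S : GStruct A P W) : Trm A P → W → W → Prop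
    | .tv a, x, y => S.rel a x y
    | .comp e f, x, z => ∃ y, semT S e x y ∧ semT S f y z
    | .union e f, x, y => semT S e x y ∨ semT S f x y
    | .plus e, x, y => Relation.TransGen (fun u v => semT S e u v) x y
    | .adom e, x, y => x = y ∧ ∀ z, ¬ semT S e x z
    | .capId e, x, y => semT S e x y ∧ x = y
    | .capNid e, x, y => semT S e x y ∧ x ≠ y
    | .test φ, x, y => x = y ∧ semF S φ x
end
mutual
  /-- Formulas of (pure) PDL with tests. -/
  inductive PFml (VA VP : Type) : Type where
    | pv : VP → PFml VA VP
    | imp : PFml VA VP → PFml VA VP → PFml VA VP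
    | fls : PFml VA VP
    | box : PTrm VA VP → PFml VA VP → PFml VA VP
  /-- Terms of (pure) PDL with tests. -/
  inductive PTrm (VA VP : Type) : Type where
    | tv : VA → PTrm VA VP
    | comp : PTrm VA VP → PTrm VA VP → PTrm VA VP
    | union : PTrm VA VP → PTrm VA VP → PTrm VA VP
    | plus : PTrm VA VP → PTrm VA VP
    | test : PFml VA VP → PTrm VA VP
end

mutual
  /-- Semantics of PDL formulas on a generalized structure. -/
  def psemF {VA VP W : Type} (S : GStruct VA VP W) : PFml VA VP → W → Prop
    | .pv p, x => S.val p x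
    | .imp φ ψ, x => psemF S φ x → psemF S ψ x
    | .fls, _ => False
    | .box e φ, x => ∀ y, psemT S e x y → psemF S φ y
  /-- Semantics of PDL terms on a generalized structure. -/
  def psemT {VA VP W : Type} (S : GStruct VA VP W) : PTrm VA VP → W → W → Prop
    | .tv a, x, y => S.rel a x y
    | .comp e f, x, z => ∃ y, psemT S e x y ∧ psemT S f y z
    | .union e f, x, y => psemT S e x y ∨ psemT S f x y
    | .plus e, x, y => Relation.TransGen (fun u v => psemT S e u v) x y
    | .test φ, x, y => x = y ∧ psemF S φ x
end

/-- Validity of a PDL formula on all structures (those with `U = W × W`). -/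
def PValidREL {VA VP : Type} (φ : PFml VA VP) : Prop :=
  ∀ (W : Type) (S : GStruct VA VP W), Nonempty W → (∀ x y, S.U x y) →
    ∀ x, psemF S φ x

mutual
  /-- Substitution instance of a PDL formula, substituting PDL_REwLA+ terms for
  term variables and PDL_REwLA+ formulas for formula variables. -/
  def instF {VA VP A P : Type} (σt : VA → Trm A P) (σf : VP → Fml A P) :
      PFml VA VP → Fml A P
    | .pv p => σf p
    | .imp φ ψ => .imp (instF σt σf φ) (instF σt σf ψ)
    | .fls => .fls
    | .box e φ => .box (instT σt σf e) (instF σt σf φ)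
  /-- Substitution instance of a PDL term. -/
  def instT {VA VP A P : Type} (σt : VA → Trm A P) (σf : VP → Fml A P) :
      PTrm VA VP → Trm A P
    | .tv a => σt a
    | .comp e f => .comp (instT σt σf e) (instT σt σf f)
    | .union e f => .union (instT σt σf e) (instT σt σf f)
    | .plus e => .plus (instT σt σf e)
    | .test φ => .test (instF σt σf φ)
end
/-- The Hilbert system `H` for PDL_REwLA+ on finite linear orders. -/
inductive HProof {A P : Type} : Fml A P → Prop where
  /-- modus ponens -/
  | mp {φ ψ : Fml A P} : HProof φ → HProof (.imp φ ψ) → HProof ψ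
  /-- necessitation -/
  | nec {φ : Fml A P} (e : Trm A P) : HProof φ → HProof (.box e φ)
  /-- (PDL): all substitution-instances of PDL formulas valid on REL -/
  | pdl {VA VP : Type} (φ : PFml VA VP) (hval : PValidREL φ)
      (σt : VA → Trm A P) (σf : VP → Fml A P) : HProof (instF σt σf φ)
  /-- (a): [eᵃ]φ ↔ [([e]F)?]φ -/
  | adomAx (e : Trm A P) (φ : Fml A P) :
      HProof (Fml.iff (.box (.adom e) φ) (.box (.test (.box e .fls)) φ))
  /-- (∩id-T) -/
  | capIdT (e : Trm A P) (φ : Fml A P) :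
      HProof (Fml.iff (.box (.capId e) φ) (.box (.test (Fml.dia (.capId e) Fml.tru)) φ))
  /-- (∩id-;) -/
  | capIdComp (e f : Trm A P) (φ : Fml A P) :
      HProof (Fml.iff (.box (.capId (.comp e f)) φ) (.box (.comp (.capId e) (.capId f)) φ))
  /-- (∩id-+) -/
  | capIdUnion (e f : Trm A P) (φ : Fml A P) :
      HProof (Fml.iff (.box (.capId (.union e f)) φ) (.box (.union (.capId e) (.capId f)) φ))
  /-- (∩id-⁺) -/
  | capIdPlus (e : Trm A P) (φ : Fml A P) :
      HProof (Fml.iff (.box (.capId (.plus e)) φ) (.box (.capId e) φ))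
  /-- (∩id-a) -/
  | capIdAdom (e : Trm A P) (φ : Fml A P) :
      HProof (Fml.iff (.box (.capId (.adom e)) φ) (.box (.adom e) φ))
  /-- (∩id-∩id) -/
  | capIdCapId (e : Trm A P) (φ : Fml A P) :
      HProof (Fml.iff (.box (.capId (.capId e)) φ) (.box (.capId e) φ))
  /-- (∩id-∩i̅d) -/
  | capIdCapNid (e : Trm A P) (φ : Fml A P) :
      HProof (Fml.iff (.box (.capId (.capNid e)) φ) Fml.tru)
  /-- (∩id-?) -/
  | capIdTest (ψ : Fml A P) (φ : Fml A P) :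
      HProof (Fml.iff (.box (.capId (.test ψ)) φ) (.box (.test ψ) φ))
  /-- (∩id-+-∩i̅d): [e]φ ↔ [e^{∩id} + e^{∩i̅d}]φ -/
  | split (e : Trm A P) (φ : Fml A P) :
      HProof (Fml.iff (.box e φ) (.box (.union (.capId e) (.capNid e)) φ))
  /-- (∩i̅d-;) -/
  | capNidComp (e f : Trm A P) (φ : Fml A P) :
      HProof (Fml.iff (.box (.capNid (.comp e f)) φ)
        (.box (.union (.union (.comp (.capNid e) (.capId f)) (.comp (.capId e) (.capNid f)))
          (.comp (.capNid e) (.capNid f))) φ))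
  /-- (∩i̅d-+) -/
  | capNidUnion (e f : Trm A P) (φ : Fml A P) :
      HProof (Fml.iff (.box (.capNid (.union e f)) φ) (.box (.union (.capNid e) (.capNid f)) φ))
  /-- (∩i̅d-⁺) -/
  | capNidPlus (e : Trm A P) (φ : Fml A P) :
      HProof (Fml.iff (.box (.capNid (.plus e)) φ) (.box (.plus (.capNid e)) φ))
  /-- (∩i̅d-a) -/
  | capNidAdom (e : Trm A P) (φ : Fml A P) :
      HProof (Fml.iff (.box (.capNid (.adom e)) φ) Fml.tru)
  /-- (∩i̅d-∩id) -/
  | capNidCapId (e : Trm A P) (φ : Fml A P) :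
      HProof (Fml.iff (.box (.capNid (.capId e)) φ) Fml.tru)
  /-- (∩i̅d-∩i̅d) -/
  | capNidCapNid (e : Trm A P) (φ : Fml A P) :
      HProof (Fml.iff (.box (.capNid (.capNid e)) φ) (.box (.capNid e) φ))
  /-- (∩i̅d-?) -/
  | capNidTest (ψ : Fml A P) (φ : Fml A P) :
      HProof (Fml.iff (.box (.capNid (.test ψ)) φ) Fml.tru)
  /-- (Löb-∩i̅d⁺) -/
  | loeb (e : Trm A P) (φ : Fml A P) :
      HProof (.imp (.box (.plus (.capNid e)) (.imp (.box (.plus (.capNid e)) φ) φ))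
        (.box (.plus (.capNid e)) φ))

/-! ### Soundness -/

theorem semF_iff {A P W : Type} (S : GStruct A P W) (φ ψ : Fml A P) (x : W) :
    semF S (Fml.iff φ ψ) x ↔ (semF S φ x ↔ semF S ψ x) := by
  simp only [Fml.iff, Fml.and, Fml.or, Fml.neg, semF]
  tauto

theorem semT_le_univ {A P W : Type} (S : GStruct A P W) (hr : ∀ x, S.U x x)
    (ht : ∀ x y z, S.U x y → S.U y z → S.U x z) :
    ∀ (e : Trm A P) (x y : W), semT S e x y → S.U x y
  | .tv a, x, y, h => by
    rw [semT] at h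
    exact S.rel_sub a x y h
  | .comp e f, x, y, h => by
    rw [semT] at h
    obtain ⟨z, h₁, h₂⟩ := h
    exact ht x z y (semT_le_univ S hr ht e x z h₁) (semT_le_univ S hr ht f z y h₂)
  | .union e f, x, y, h => by
    rw [semT] at h
    exact h.elim (semT_le_univ S hr ht e x y) (semT_le_univ S hr ht f x y)
  | .plus e, x, y, h => by
    rw [semT] at h
    induction h with
    | single h => exact semT_le_univ S hr ht e _ _ h
    | tail _ h ih => exact ht _ _ _ ih (semT_le_univ S hr ht e _ _ h)
  | .adom e, x, y, h => by
    rw [semT] at h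
    exact h.1 ▸ hr x
  | .capId e, x, y, h => by
    rw [semT] at h
    exact h.2 ▸ hr x
  | .capNid e, x, y, h => by
    rw [semT] at h
    exact semT_le_univ S hr ht e x y h.1
  | .test φ, x, y, h => by
    rw [semT] at h
    exact h.1 ▸ hr x

/-- The structure with full universal relation and the given interpretations. -/
def GStruct.free {VA VP W : Type} (rel : VA → W → W → Prop) (val : VP → W → Prop) :
    GStruct VA VP W where
  U _ _ := True
  rel := rel
  rel_sub _ _ _ _ := trivial
  val := val

/-- The PDL structure interpreting variables by the semantics of their substitutes. -/
def GStruct.pull {VA VP A P W : Type} (S : GStruct A P W) (σt : VA → Trm A P)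
    (σf : VP → Fml A P) : GStruct VA VP W :=
  .free (fun a => semT S (σt a)) (fun p => semF S (σf p))

mutual
theorem semF_inst {VA VP A P W : Type} (S : GStruct A P W) (σt : VA → Trm A P)
    (σf : VP → Fml A P) :
    ∀ (φ : PFml VA VP) (x : W), semF S (instF σt σf φ) x ↔ psemF (S.pull σt σf) φ x
  | .pv p, x => by simp only [instF, psemF]; rfl
  | .imp φ ψ, x => by
    simp only [instF, psemF, semF, semF_inst S σt σf φ x, semF_inst S σt σf ψ x]
  | .fls, x => by simp only [instF, psemF, semF]
  | .box e φ, x => by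
    simp only [instF, psemF, semF, semT_inst S σt σf e, semF_inst S σt σf φ]
theorem semT_inst {VA VP A P W : Type} (S : GStruct A P W) (σt : VA → Trm A P)
    (σf : VP → Fml A P) :
    ∀ (e : PTrm VA VP) (x y : W), semT S (instT σt σf e) x y ↔ psemT (S.pull σt σf) e x y
  | .tv a, x, y => by simp only [instT, psemT]; rfl
  | .comp e f, x, y => by
    simp only [instT, psemT, semT, semT_inst S σt σf e, semT_inst S σt σf f]
  | .union e f, x, y => by
    simp only [instT, psemT, semT, semT_inst S σt σf e, semT_inst S σt σf f]
  | .plus e, x, y => by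
    simp only [instT, psemT, semT, semT_inst S σt σf e]
  | .test φ, x, y => by
    simp only [instT, psemT, semT, semF_inst S σt σf φ]
end

theorem semF_box_congr {A P W : Type} {S : GStruct A P W} {e f : Trm A P} (φ : Fml A P) {x : W}
    (h : ∀ y, semT S e x y ↔ semT S f x y) :
    semF S (Fml.iff (.box e φ) (.box f φ)) x := by
  simp only [semF_iff, semF, h]

theorem semF_box_empty {A P W : Type} {S : GStruct A P W} {e : Trm A P} (φ : Fml A P) {x : W}
    (h : ∀ y, ¬ semT S e x y) :
    semF S (Fml.iff (.box e φ) Fml.tru) x := by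
  simp [semF_iff, semF, Fml.tru, Fml.neg, h]

theorem HProof.sound {A P W : Type} {φ : Fml A P} (h : HProof φ) (S : GStruct A P W)
    (hS : FinLin S) : ∀ x, semF S φ x := by
  obtain ⟨hne, hfin, hr, ht, ha, -⟩ := hS
  have hU := semT_le_univ S hr ht
  have hplus : ∀ (e : Trm A P) x y, Relation.TransGen (fun u v => semT S e u v) x y →
      S.U x y := fun e x y h => hU (.plus e) x y (by rwa [semT])
  have hcyc : ∀ (e : Trm A P) x y, Relation.TransGen (fun u v => semT S e u v) x y →
      S.U y x → semT S e x x := by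
    intro e x y h hyx
    rcases Relation.TransGen.head'_iff.1 h with ⟨z, hxz, hzy⟩
    have hzy' : S.U z y := by
      rcases Relation.reflTransGen_iff_eq_or_transGen.1 hzy with rfl | h'
      · exact hr _
      · exact hplus e _ _ h'
    have : x = z := ha _ _ (hU e _ _ hxz) (ht _ _ _ hzy' hyx)
    exact this ▸ hxz
  have hstrict : ∀ (e : Trm A P) x y,
      Relation.TransGen (fun u v => semT S e u v ∧ u ≠ v) x y →
      Relation.TransGen (fun u v => semT S e u v) x y ∧ x ≠ y := by
    intro e x y h
    have hmono := Relation.TransGen.mono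
      (show (fun u v => semT S e u v ∧ u ≠ v) ≤ fun u v => semT S e u v from fun _ _ h => h.1)
    refine ⟨hmono _ _ h, ?_⟩
    rintro rfl
    rcases Relation.TransGen.head'_iff.1 h with ⟨z, hxz, hzy⟩
    refine hxz.2 (ha _ _ (hU _ _ _ hxz.1) ?_)
    rcases Relation.reflTransGen_iff_eq_or_transGen.1 hzy with h' | h'
    · exact h' ▸ hr _
    · exact hplus e _ _ (hmono _ _ h')
  induction h with
  | mp _ _ ih₁ ih₂ =>
    intro x
    have := ih₂ x
    rw [semF] at this
    exact this (ih₁ x)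
  | nec e _ ih =>
    intro x
    rw [semF]
    exact fun y _ => ih y
  | pdl φ hval σt σf =>
    intro x
    rw [semF_inst]
    exact hval W _ hne (fun _ _ => trivial) x
  | adomAx e φ => exact fun x => semF_box_congr φ fun y => by simp only [semT, semF]
  | capIdT e φ =>
    refine fun x => semF_box_congr φ fun y => ?_
    simp only [semT, semF, Fml.dia, Fml.neg, Fml.tru]
    constructor
    · rintro ⟨h, rfl⟩
      exact ⟨rfl, fun h' => h' x ⟨h, rfl⟩ id⟩
    · rintro ⟨rfl, h⟩
      by_contra hn
      exact h fun y hy => absurd (hy.2 ▸ hy) hn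
  | capIdComp e f φ =>
    refine fun x => semF_box_congr φ fun y => ?_
    simp only [semT]
    constructor
    · rintro ⟨⟨z, h₁, h₂⟩, rfl⟩
      obtain rfl := ha _ _ (hU _ _ _ h₁) (hU _ _ _ h₂)
      exact ⟨x, ⟨h₁, rfl⟩, h₂, rfl⟩
    · rintro ⟨z, ⟨h₁, rfl⟩, h₂, rfl⟩
      exact ⟨⟨x, h₁, h₂⟩, rfl⟩
  | capIdUnion e f φ =>
    refine fun x => semF_box_congr φ fun y => ?_
    simp only [semT]
    tauto
  | capIdPlus e φ =>
    refine fun x => semF_box_congr φ fun y => ?_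
    simp only [semT]
    constructor
    · rintro ⟨h, rfl⟩
      exact ⟨hcyc e x x h (hr x), rfl⟩
    · rintro ⟨h, rfl⟩
      exact ⟨.single h, rfl⟩
  | capIdAdom e φ =>
    refine fun x => semF_box_congr φ fun y => ?_
    simp only [semT]
    tauto
  | capIdCapId e φ =>
    refine fun x => semF_box_congr φ fun y => ?_
    simp only [semT]
    tauto
  | capIdCapNid e φ =>
    refine fun x => semF_box_empty φ fun y => ?_
    simp only [semT]
    tauto
  | capIdTest ψ φ =>
    refine fun x => semF_box_congr φ fun y => ?_
    simp only [semT]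
    tauto
  | split e φ =>
    refine fun x => semF_box_congr φ fun y => ?_
    simp only [semT]
    tauto
  | capNidComp e f φ =>
    refine fun x => semF_box_congr φ fun y => ?_
    simp only [semT]
    constructor
    · rintro ⟨⟨z, h₁, h₂⟩, hn⟩
      by_cases hxz : x = z
      · subst hxz
        exact .inl (.inr ⟨x, ⟨h₁, rfl⟩, h₂, hn⟩)
      · by_cases hzy : z = y
        · subst hzy
          exact .inl (.inl ⟨z, ⟨h₁, hn⟩, h₂, rfl⟩)
        · exact .inr ⟨z, ⟨h₁, hxz⟩, h₂, hzy⟩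
    · rintro ((⟨z, ⟨h₁, hn⟩, h₂, rfl⟩ | ⟨z, ⟨h₁, rfl⟩, h₂, hn⟩) | ⟨z, ⟨h₁, hn⟩, h₂, hn'⟩)
      · exact ⟨⟨z, h₁, h₂⟩, hn⟩
      · exact ⟨⟨x, h₁, h₂⟩, hn⟩
      · refine ⟨⟨z, h₁, h₂⟩, ?_⟩
        rintro rfl
        exact hn (ha _ _ (hU _ _ _ h₁) (hU _ _ _ h₂))
  | capNidUnion e f φ =>
    refine fun x => semF_box_congr φ fun y => ?_
    simp only [semT]
    tauto
  | capNidPlus e φ =>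
    refine fun x => semF_box_congr φ fun y => ?_
    simp only [semT]
    constructor
    · rintro ⟨h, hn⟩
      induction h with
      | single h => exact .single ⟨h, hn⟩
      | @tail b c hb hbc ih =>
        by_cases hxb : x = b
        · subst hxb
          exact .single ⟨hbc, hn⟩
        · by_cases hbc' : b = c
          · subst hbc'
            exact ih hxb
          · exact .tail (ih hxb) ⟨hbc, hbc'⟩
    · exact hstrict e x y
  | capNidAdom e φ =>
    refine fun x => semF_box_empty φ fun y => ?_
    simp only [semT]
    tauto
  | capNidCapId e φ =>
    refine fun x => semF_box_empty φ fun y => ?_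
    simp only [semT]
    tauto
  | capNidCapNid e φ =>
    refine fun x => semF_box_congr φ fun y => ?_
    simp only [semT]
    tauto
  | capNidTest ψ φ =>
    refine fun x => semF_box_empty φ fun y => ?_
    simp only [semT]
    tauto
  | loeb e φ =>
    intro x
    simp only [semF, semT]
    set r : W → W → Prop := fun u v => semT S e u v ∧ u ≠ v
    have hwf : WellFounded (fun u v : W => Relation.TransGen r v u) := by
      have : Std.Irrefl (fun u v : W => Relation.TransGen r v u) :=
        ⟨fun u h => (hstrict e u u h).2 rfl⟩
      have : IsTrans W (fun u v : W => Relation.TransGen r v u) :=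
        ⟨fun _ _ _ h₁ h₂ => h₂.trans h₁⟩
      exact Finite.wellFounded_of_trans_of_irrefl _
    intro h y
    induction y using hwf.induction with
    | _ y ih => exact fun hxy => h y hxy fun z hyz => ih z hyz (hxy.trans hyz)

/-! ### Derived rules -/

namespace HProof

variable {A P : Type}

/-- Derivability of valid PDL formulas whose variables are formulas and terms themselves. -/
theorem ofValid (φ : PFml (Trm A P) (Fml A P)) (hval : PValidREL φ) : HProof (instF id id φ) :=
  .pdl φ hval id id

theorem imp_refl (φ : Fml A P) : HProof (.imp φ φ) := by
  have := ofValid (A := A) (P := P) (.imp (.pv φ) (.pv φ))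
    (fun W S _ _ x => by simp only [psemF]; exact id)
  simpa only [instF, id] using this

theorem imp_trans {φ ψ χ : Fml A P} (h₁ : HProof (.imp φ ψ)) (h₂ : HProof (.imp ψ χ)) :
    HProof (.imp φ χ) := by
  have := ofValid (A := A) (P := P) (.imp (.imp (.pv φ) (.pv ψ))
    (.imp (.imp (.pv ψ) (.pv χ)) (.imp (.pv φ) (.pv χ))))
    (fun W S _ _ x => by simp only [psemF]; tauto)
  simp only [instF, id] at this
  exact h₂.mp (h₁.mp this)

theorem imp_weaken {φ : Fml A P} (ψ : Fml A P) (h : HProof φ) : HProof (.imp ψ φ) := by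
  have := ofValid (A := A) (P := P) (.imp (.pv φ) (.imp (.pv ψ) (.pv φ)))
    (fun W S _ _ x => by simp only [psemF]; tauto)
  simp only [instF, id] at this
  exact h.mp this

theorem imp_congr {φ φ' ψ ψ' : Fml A P} (h₁ : HProof (.imp φ' φ)) (h₂ : HProof (.imp ψ ψ')) :
    HProof (.imp (.imp φ ψ) (.imp φ' ψ')) := by
  have := ofValid (A := A) (P := P) (.imp (.imp (.pv φ') (.pv φ))
    (.imp (.imp (.pv ψ) (.pv ψ')) (.imp (.imp (.pv φ) (.pv ψ)) (.imp (.pv φ') (.pv ψ')))))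
    (fun W S _ _ x => by simp only [psemF]; tauto)
  simp only [instF, id] at this
  exact h₂.mp (h₁.mp this)

theorem of_iff {φ ψ : Fml A P} (h : HProof (Fml.iff φ ψ)) :
    HProof (.imp φ ψ) ∧ HProof (.imp ψ φ) := by
  have h₁ := ofValid (A := A) (P := P)
    (.imp (.imp (.imp (.imp (.imp (.imp (.pv φ) (.pv ψ)) .fls) .fls)
      (.imp (.imp (.pv ψ) (.pv φ)) .fls)) .fls) (.imp (.pv φ) (.pv ψ)))
    (fun W S _ _ x => by simp only [psemF]; tauto)
  have h₂ := ofValid (A := A) (P := P)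
    (.imp (.imp (.imp (.imp (.imp (.imp (.pv φ) (.pv ψ)) .fls) .fls)
      (.imp (.imp (.pv ψ) (.pv φ)) .fls)) .fls) (.imp (.pv ψ) (.pv φ)))
    (fun W S _ _ x => by simp only [psemF]; tauto)
  simp only [instF, id] at h₁ h₂
  exact ⟨h.mp h₁, h.mp h₂⟩

theorem box_mono (e : Trm A P) {φ ψ : Fml A P} (h : HProof (.imp φ ψ)) :
    HProof (.imp (.box e φ) (.box e ψ)) := by
  have := ofValid (A := A) (P := P) (.imp (.box (.tv e) (.imp (.pv φ) (.pv ψ)))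
    (.imp (.box (.tv e) (.pv φ)) (.box (.tv e) (.pv ψ))))
    (fun W S _ _ x => by
      simp only [psemF]
      exact fun h₁ h₂ y hy => h₁ y hy (h₂ y hy))
  simp only [instF, instT, id] at this
  exact (h.nec e).mp this

end HProof

/-- Provable equivalence of formulas. -/
def Fml.Equiv {A P : Type} (φ ψ : Fml A P) : Prop :=
  HProof (.imp φ ψ) ∧ HProof (.imp ψ φ)

/-- `e.Le f`: every box over `e` provably implies the same box over `f`. -/
def Trm.Le {A P : Type} (e f : Trm A P) : Prop :=
  ∀ χ, HProof (.imp (.box e χ) (.box f χ))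

/-- Provable modal equivalence of terms. -/
def Trm.Equiv {A P : Type} (e f : Trm A P) : Prop := e.Le f ∧ f.Le e

namespace Trm

variable {A P : Type}

theorem Le.comp {e e' f f' : Trm A P} (h₁ : e.Le e') (h₂ : f.Le f') :
    (e.comp f).Le (e'.comp f') := by
  intro χ
  have h := HProof.ofValid (A := A) (P := P)
    (.imp (.box (.comp (.tv e) (.tv f)) (.pv χ)) (.box (.tv e) (.box (.tv f) (.pv χ))))
    (fun W S _ _ x => by simp only [psemF, psemT]; exact fun h y hy z hz => h z ⟨y, hy, hz⟩)
  have h' := HProof.ofValid (A := A) (P := P)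
    (.imp (.box (.tv e') (.box (.tv f') (.pv χ))) (.box (.comp (.tv e') (.tv f')) (.pv χ)))
    (fun W S _ _ x => by
      simp only [psemF, psemT]
      exact fun h z ⟨y, hy, hz⟩ => h y hy z hz)
  simp only [instF, instT, id] at h h'
  exact h.imp_trans ((h₁ _).imp_trans ((HProof.box_mono e' (h₂ χ)).imp_trans h'))

theorem Le.union {e e' f f' : Trm A P} (h₁ : e.Le e') (h₂ : f.Le f') :
    (e.union f).Le (e'.union f') := by
  intro χ
  have h := HProof.ofValid (A := A) (P := P)
    (.imp (.imp (.box (.tv e) (.pv χ)) (.box (.tv e') (.pv χ)))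
    (.imp (.imp (.box (.tv f) (.pv χ)) (.box (.tv f') (.pv χ)))
    (.imp (.box (.union (.tv e) (.tv f)) (.pv χ)) (.box (.union (.tv e') (.tv f')) (.pv χ)))))
    (fun W S _ _ x => by
      simp only [psemF, psemT]
      intro h₁ h₂ h y hy
      exact hy.elim (h₁ (fun z hz => h z (.inl hz)) y) (h₂ (fun z hz => h z (.inr hz)) y))
  simp only [instF, instT, id] at h
  exact (h₂ χ).mp ((h₁ χ).mp h)

theorem Le.plus {e f : Trm A P} (h : e.Le f) : e.plus.Le f.plus := by
  intro χ
  have h₁ := HProof.ofValid (A := A) (P := P)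
    (.imp (.box (.plus (.tv e)) (.pv χ)) (.box (.tv e) (.pv χ)))
    (fun W S _ _ x => by simp only [psemF, psemT]; exact fun h y hy => h y (.single hy))
  have h₂ := HProof.ofValid (A := A) (P := P)
    (.imp (.box (.plus (.tv e)) (.pv χ)) (.box (.tv e) (.box (.plus (.tv e)) (.pv χ))))
    (fun W S _ _ x => by
      simp only [psemF, psemT]
      exact fun h y hy z hz => h z (.head hy hz))
  have h₃ := HProof.ofValid (A := A) (P := P)
    (let p := .pv (.box e.plus χ)
     let q := .pv χ
     .imp (.box (.plus (.tv f)) (.imp p (.box (.tv f) q)))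
      (.imp (.box (.plus (.tv f)) (.imp p (.box (.tv f) p)))
      (.imp (.imp p (.box (.tv f) q)) (.imp (.imp p (.box (.tv f) p))
      (.imp p (.box (.plus (.tv f)) q))))))
    (fun W S _ _ x => by
      simp only [psemF, psemT]
      intro h₁ h₂ h₃ h₄ hx y hy
      suffices S.val χ y ∧ S.val (.box e.plus χ) y from this.1
      induction hy with
      | single hy => exact ⟨h₃ hx _ hy, h₄ hx _ hy⟩
      | tail hb hbc ih => exact ⟨h₁ _ hb ih.2 _ hbc, h₂ _ hb ih.2 _ hbc⟩)
  simp only [instF, instT, id] at h₁ h₂ h₃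
  have k₁ := h₁.imp_trans (h χ)
  have k₂ := h₂.imp_trans (h _)
  exact k₂.mp (k₁.mp ((k₂.nec _).mp ((k₁.nec _).mp h₃)))

theorem Le.test {φ ψ : Fml A P} (h : HProof (.imp ψ φ)) : (Trm.test φ).Le (.test ψ) := by
  intro χ
  have h₁ := HProof.ofValid (A := A) (P := P) (.imp (.imp (.pv ψ) (.pv φ))
    (.imp (.box (.test (.pv φ)) (.pv χ)) (.box (.test (.pv ψ)) (.pv χ))))
    (fun W S _ _ x => by
      simp only [psemF, psemT]
      rintro h h' y ⟨rfl, hy⟩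
      exact h' x ⟨rfl, h hy⟩)
  simp only [instF, instT, id] at h₁
  exact h.mp h₁

namespace Equiv

theorem refl (e : Trm A P) : e.Equiv e := ⟨fun _ => .imp_refl _, fun _ => .imp_refl _⟩

theorem symm {e f : Trm A P} (h : e.Equiv f) : f.Equiv e := ⟨h.2, h.1⟩

theorem trans {e f g : Trm A P} (h₁ : e.Equiv f) (h₂ : f.Equiv g) : e.Equiv g :=
  ⟨fun χ => (h₁.1 χ).imp_trans (h₂.1 χ), fun χ => (h₂.2 χ).imp_trans (h₁.2 χ)⟩

theorem comp {e e' f f' : Trm A P} (h₁ : e.Equiv e') (h₂ : f.Equiv f') :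
    (e.comp f).Equiv (e'.comp f') := ⟨h₁.1.comp h₂.1, h₁.2.comp h₂.2⟩

theorem union {e e' f f' : Trm A P} (h₁ : e.Equiv e') (h₂ : f.Equiv f') :
    (e.union f).Equiv (e'.union f') := ⟨h₁.1.union h₂.1, h₁.2.union h₂.2⟩

theorem plus {e f : Trm A P} (h : e.Equiv f) : e.plus.Equiv f.plus := ⟨h.1.plus, h.2.plus⟩

theorem test {φ ψ : Fml A P} (h : φ.Equiv ψ) : (Trm.test φ).Equiv (.test ψ) :=
  ⟨.test h.2, .test h.1⟩

theorem box {e f : Trm A P} (h : e.Equiv f) {φ ψ : Fml A P} (h' : φ.Equiv ψ) :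
    (Fml.box e φ).Equiv (.box f ψ) :=
  ⟨(h.1 φ).imp_trans (.box_mono f h'.1), (h.2 ψ).imp_trans (.box_mono e h'.2)⟩

theorem of_iff {e f : Trm A P} (h : ∀ χ, HProof (Fml.iff (.box e χ) (.box f χ))) : e.Equiv f :=
  ⟨fun χ => (h χ).of_iff.1, fun χ => (h χ).of_iff.2⟩

theorem of_iff_tru {e : Trm A P} (h : ∀ χ, HProof (Fml.iff (.box e χ) Fml.tru)) :
    e.Equiv (.test .fls) := by
  refine ⟨fun χ => .imp_weaken _ ?_, fun χ => .imp_weaken _ ?_⟩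
  · have := HProof.ofValid (A := A) (P := P) (.box (.test .fls) (.pv χ))
      (fun W S _ _ x => by simp [psemF, psemT])
    simpa only [instF, instT, id] using this
  · exact (HProof.imp_refl _).mp (h χ).of_iff.2

end Equiv

end Trm

/-! ### Translation into PDL -/

namespace PFml

/-- Negation. -/
def neg {VA VP : Type} (φ : PFml VA VP) : PFml VA VP := .imp φ .fls

/-- Disjunction. -/
def or {VA VP : Type} (φ ψ : PFml VA VP) : PFml VA VP := .imp (neg φ) ψ

/-- Conjunction. -/
def and {VA VP : Type} (φ ψ : PFml VA VP) : PFml VA VP := neg (.imp φ (neg ψ))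

end PFml

mutual
/-- Translation to PDL: a term variable `a` stands for `a ∖ id`, and the formula variable
`.inr a` for the points at which `a` loops. -/
def Fml.toPDL {A P : Type} : Fml A P → PFml A (P ⊕ A)
  | .pv p => .pv (.inl p)
  | .imp φ ψ => .imp φ.toPDL ψ.toPDL
  | .fls => .fls
  | .box e φ => .box (.union (.test e.loopF) e.strictT) φ.toPDL
/-- The PDL formula expressing that a term loops. -/
def Trm.loopF {A P : Type} : Trm A P → PFml A (P ⊕ A)
  | .tv a => .pv (.inr a)
  | .comp e f => .and e.loopF f.loopF
  | .union e f => .or e.loopF f.loopF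
  | .plus e => e.loopF
  | .adom e => .box (.union (.test e.loopF) e.strictT) .fls
  | .capId e => e.loopF
  | .capNid _ => .fls
  | .test φ => φ.toPDL
/-- The PDL term expressing the non-identity part of a term. -/
def Trm.strictT {A P : Type} : Trm A P → PTrm A (P ⊕ A)
  | .tv a => .tv a
  | .comp e f => .union (.union (.comp e.strictT (.test f.loopF))
      (.comp (.test e.loopF) f.strictT)) (.comp e.strictT f.strictT)
  | .union e f => .union e.strictT f.strictT
  | .plus e => .plus e.strictT
  | .adom _ => .test .fls
  | .capId _ => .test .fls
  | .capNid e => e.strictT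
  | .test _ => .test .fls
end

/-- Substitution of the PDL term variables used by the translation. -/
def backT {A P : Type} (a : A) : Trm A P := .capNid (.tv a)

/-- Substitution of the PDL formula variables used by the translation. -/
def backF {A P : Type} : P ⊕ A → Fml A P
  | .inl p => .pv p
  | .inr a => Fml.dia (.capId (.tv a)) Fml.tru

section Back

variable {A P : Type}

theorem test_and_equiv (φ ψ : PFml A (P ⊕ A)) :
    Trm.Equiv (.comp (.test (instF backT backF φ)) (.test (instF backT backF ψ)))
      (.test (instF backT backF (.and φ ψ))) := by
  constructor
  · intro χ
    have := HProof.ofValid (A := A) (P := P) (let p := .pv (instF backT backF φ)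
      let q := .pv (instF backT backF ψ)
      .imp (.box (.comp (.test p) (.test q)) (.pv χ)) (.box (.test (.and p q)) (.pv χ)))
      (fun W S _ _ x => by
        simp only [psemF, psemT, PFml.and, PFml.neg]
        rintro h y ⟨rfl, hy⟩
        refine h x ⟨x, ⟨rfl, ?_⟩, rfl, ?_⟩ <;> tauto)
    simpa only [instF, instT, id, PFml.and, PFml.neg] using this
  · intro χ
    have := HProof.ofValid (A := A) (P := P) (let p := .pv (instF backT backF φ)
      let q := .pv (instF backT backF ψ)
      .imp (.box (.test (.and p q)) (.pv χ)) (.box (.comp (.test p) (.test q)) (.pv χ)))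
      (fun W S _ _ x => by
        simp only [psemF, psemT, PFml.and, PFml.neg]
        rintro h y ⟨z, ⟨rfl, h₁⟩, rfl, h₂⟩
        exact h x ⟨rfl, fun h => h h₁ h₂⟩)
    simpa only [instF, instT, id, PFml.and, PFml.neg] using this

theorem test_or_equiv (φ ψ : PFml A (P ⊕ A)) :
    Trm.Equiv (.union (.test (instF backT backF φ)) (.test (instF backT backF ψ)))
      (.test (instF backT backF (.or φ ψ))) := by
  constructor
  · intro χ
    have := HProof.ofValid (A := A) (P := P) (let p := .pv (instF backT backF φ)
      let q := .pv (instF backT backF ψ)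
      .imp (.box (.union (.test p) (.test q)) (.pv χ)) (.box (.test (.or p q)) (.pv χ)))
      (fun W S _ _ x => by
        simp only [psemF, psemT, PFml.or, PFml.neg]
        rintro h y ⟨rfl, hy⟩
        refine h x ?_
        tauto)
    simpa only [instF, instT, id, PFml.or, PFml.neg] using this
  · intro χ
    have := HProof.ofValid (A := A) (P := P) (let p := .pv (instF backT backF φ)
      let q := .pv (instF backT backF ψ)
      .imp (.box (.test (.or p q)) (.pv χ)) (.box (.union (.test p) (.test q)) (.pv χ)))
      (fun W S _ _ x => by
        simp only [psemF, psemT, PFml.or, PFml.neg]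
        rintro h y (⟨rfl, hy⟩ | ⟨rfl, hy⟩) <;> exact h x ⟨rfl, by tauto⟩)
    simpa only [instF, instT, id, PFml.or, PFml.neg] using this

mutual
theorem toPDL_equiv : ∀ φ : Fml A P, φ.Equiv (instF backT backF φ.toPDL)
  | .pv p => by
    simp only [Fml.toPDL, instF, backF]
    exact ⟨.imp_refl _, .imp_refl _⟩
  | .imp φ ψ => by
    simp only [Fml.toPDL, instF]
    have h₁ := toPDL_equiv φ
    have h₂ := toPDL_equiv ψ
    exact ⟨.imp_congr h₁.2 h₂.1, .imp_congr h₁.1 h₂.2⟩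
  | .fls => by
    simp only [Fml.toPDL, instF]
    exact ⟨.imp_refl _, .imp_refl _⟩
  | .box e φ => by
    simp only [Fml.toPDL, instF, instT]
    exact ((Trm.Equiv.of_iff (HProof.split e)).trans
      ((capId_equiv e).union (capNid_equiv e))).box (toPDL_equiv φ)
theorem capId_equiv : ∀ e : Trm A P, (Trm.capId e).Equiv (.test (instF backT backF e.loopF))
  | .tv a => by
    simp only [Trm.loopF, instF, backF]
    exact .of_iff (HProof.capIdT _)
  | .comp e f => by
    simp only [Trm.loopF]
    exact (Trm.Equiv.of_iff (HProof.capIdComp e f)).trans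
      (((capId_equiv e).comp (capId_equiv f)).trans (test_and_equiv _ _))
  | .union e f => by
    simp only [Trm.loopF]
    exact (Trm.Equiv.of_iff (HProof.capIdUnion e f)).trans
      (((capId_equiv e).union (capId_equiv f)).trans (test_or_equiv _ _))
  | .plus e => by
    simp only [Trm.loopF]
    exact (Trm.Equiv.of_iff (HProof.capIdPlus e)).trans (capId_equiv e)
  | .adom e => by
    simp only [Trm.loopF, instF, instT]
    refine (Trm.Equiv.of_iff (HProof.capIdAdom e)).trans
      ((Trm.Equiv.of_iff (HProof.adomAx e)).trans (.test ?_))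
    exact ((Trm.Equiv.of_iff (HProof.split e)).trans
      ((capId_equiv e).union (capNid_equiv e))).box ⟨.imp_refl _, .imp_refl _⟩
  | .capId e => by
    simp only [Trm.loopF]
    exact (Trm.Equiv.of_iff (HProof.capIdCapId e)).trans (capId_equiv e)
  | .capNid e => by
    simp only [Trm.loopF, instF]
    exact .of_iff_tru (HProof.capIdCapNid e)
  | .test φ => by
    simp only [Trm.loopF]
    exact (Trm.Equiv.of_iff (HProof.capIdTest φ)).trans (.test (toPDL_equiv φ))
theorem capNid_equiv : ∀ e : Trm A P, (Trm.capNid e).Equiv (instT backT backF e.strictT)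
  | .tv a => by
    simp only [Trm.strictT, instT, backT]
    exact .refl _
  | .comp e f => by
    simp only [Trm.strictT, instT]
    exact (Trm.Equiv.of_iff (HProof.capNidComp e f)).trans
      ((((capNid_equiv e).comp (capId_equiv f)).union
        ((capId_equiv e).comp (capNid_equiv f))).union ((capNid_equiv e).comp (capNid_equiv f)))
  | .union e f => by
    simp only [Trm.strictT, instT]
    exact (Trm.Equiv.of_iff (HProof.capNidUnion e f)).trans
      ((capNid_equiv e).union (capNid_equiv f))
  | .plus e => by
    simp only [Trm.strictT, instT]
    exact (Trm.Equiv.of_iff (HProof.capNidPlus e)).trans (capNid_equiv e).plus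
  | .adom e => by
    simp only [Trm.strictT, instT, instF]
    exact .of_iff_tru (HProof.capNidAdom e)
  | .capId e => by
    simp only [Trm.strictT, instT, instF]
    exact .of_iff_tru (HProof.capNidCapId e)
  | .capNid e => by
    simp only [Trm.strictT]
    exact (Trm.Equiv.of_iff (HProof.capNidCapNid e)).trans (capNid_equiv e)
  | .test φ => by
    simp only [Trm.strictT, instT, instF]
    exact .of_iff_tru (HProof.capNidTest φ)
end

end Back

/-! ### Guarded PDL formulas -/

/-- Syntactic sufficient condition for a PDL term to move strictly along any transitive
relation containing the term variables. -/
def PTrm.Strict {VA VP : Type} : PTrm VA VP → Prop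
  | .tv _ => True
  | .comp e f => e.Strict ∨ f.Strict
  | .union e f => e.Strict ∧ f.Strict
  | .plus e => e.Strict
  | .test φ => φ = .fls

mutual
/-- All term variables are in `l` and iteration is only applied to strict terms. -/
def PFml.Guarded {VA VP : Type} (l : List VA) : PFml VA VP → Prop
  | .pv _ => True
  | .imp φ ψ => φ.Guarded l ∧ ψ.Guarded l
  | .fls => True
  | .box e φ => e.Guarded l ∧ φ.Guarded l
/-- All term variables are in `l` and iteration is only applied to strict terms. -/
def PTrm.Guarded {VA VP : Type} (l : List VA) : PTrm VA VP → Prop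
  | .tv a => a ∈ l
  | .comp e f => e.Guarded l ∧ f.Guarded l
  | .union e f => e.Guarded l ∧ f.Guarded l
  | .plus e => e.Guarded l ∧ e.Strict
  | .test φ => φ.Guarded l
end

mutual
/-- The term variables of a formula. -/
def Fml.vars {A P : Type} : Fml A P → List A
  | .pv _ => []
  | .imp φ ψ => φ.vars ++ ψ.vars
  | .fls => []
  | .box e φ => e.vars ++ φ.vars
/-- The term variables of a term. -/
def Trm.vars {A P : Type} : Trm A P → List A
  | .tv a => [a]
  | .comp e f => e.vars ++ f.vars
  | .union e f => e.vars ++ f.vars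
  | .plus e => e.vars
  | .adom e => e.vars
  | .capId e => e.vars
  | .capNid e => e.vars
  | .test φ => φ.vars
end

mutual
theorem toPDL_guarded {A P : Type} (l : List A) :
    ∀ φ : Fml A P, φ.vars ⊆ l → φ.toPDL.Guarded l
  | .pv p, _ => by simp only [Fml.toPDL, PFml.Guarded]
  | .imp φ ψ, h => by
    simp only [Fml.vars, List.append_subset] at h
    simp only [Fml.toPDL, PFml.Guarded]
    exact ⟨toPDL_guarded l φ h.1, toPDL_guarded l ψ h.2⟩
  | .fls, _ => by simp only [Fml.toPDL, PFml.Guarded]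
  | .box e φ, h => by
    simp only [Fml.vars, List.append_subset] at h
    simp only [Fml.toPDL, PFml.Guarded, PTrm.Guarded]
    have he := loopF_strictT_guarded l e h.1
    exact ⟨⟨he.1, he.2.1⟩, toPDL_guarded l φ h.2⟩
theorem loopF_strictT_guarded {A P : Type} (l : List A) :
    ∀ e : Trm A P, e.vars ⊆ l →
      e.loopF.Guarded l ∧ e.strictT.Guarded l ∧ e.strictT.Strict
  | .tv a, h => by
    simp only [Trm.vars, List.cons_subset] at h
    simp [Trm.loopF, Trm.strictT, PFml.Guarded, PTrm.Guarded, PTrm.Strict, h.1]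
  | .comp e f, h => by
    simp only [Trm.vars, List.append_subset] at h
    have he := loopF_strictT_guarded l e h.1
    have hf := loopF_strictT_guarded l f h.2
    simp [Trm.loopF, Trm.strictT, PFml.Guarded, PTrm.Guarded, PTrm.Strict, PFml.and, PFml.neg,
      he, hf]
  | .union e f, h => by
    simp only [Trm.vars, List.append_subset] at h
    have he := loopF_strictT_guarded l e h.1
    have hf := loopF_strictT_guarded l f h.2
    simp [Trm.loopF, Trm.strictT, PFml.Guarded, PTrm.Guarded, PTrm.Strict, PFml.or, PFml.neg,
      he, hf]
  | .plus e, h => by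
    simp only [Trm.vars] at h
    have he := loopF_strictT_guarded l e h
    simp [Trm.loopF, Trm.strictT, PTrm.Guarded, PTrm.Strict, he]
  | .adom e, h => by
    simp only [Trm.vars] at h
    have he := loopF_strictT_guarded l e h
    simp [Trm.loopF, Trm.strictT, PFml.Guarded, PTrm.Guarded, PTrm.Strict, he]
  | .capId e, h => by
    simp only [Trm.vars] at h
    have he := loopF_strictT_guarded l e h
    simp [Trm.loopF, Trm.strictT, PFml.Guarded, PTrm.Guarded, PTrm.Strict, he]
  | .capNid e, h => by
    simp only [Trm.vars] at h
    have he := loopF_strictT_guarded l e h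
    simp [Trm.loopF, Trm.strictT, PFml.Guarded, he]
  | .test φ, h => by
    simp only [Trm.vars] at h
    have hφ := toPDL_guarded l φ h
    simp [Trm.loopF, Trm.strictT, PFml.Guarded, PTrm.Guarded, PTrm.Strict, hφ]
end

theorem psemT_eq_or_lt {VA VP K : Type} (N : GStruct VA VP K) {r : K → K → Prop}
    (hr : ∀ a x y, N.rel a x y → r x y) (ht : ∀ x y z, r x y → r y z → r x z) :
    ∀ (e : PTrm VA VP) (x y : K), psemT N e x y → (x = y ∨ r x y) ∧ (e.Strict → r x y)
  | .tv a, x, y, h => by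
    rw [psemT] at h
    exact ⟨.inr (hr a x y h), fun _ => hr a x y h⟩
  | .comp e f, x, y, h => by
    rw [psemT] at h
    obtain ⟨z, h₁, h₂⟩ := h
    obtain ⟨h₁, h₁'⟩ := psemT_eq_or_lt N hr ht e x z h₁
    obtain ⟨h₂, h₂'⟩ := psemT_eq_or_lt N hr ht f z y h₂
    rw [PTrm.Strict]
    constructor
    · rcases h₁ with rfl | h₁
      · exact h₂
      · rcases h₂ with rfl | h₂
        · exact .inr h₁
        · exact .inr (ht _ _ _ h₁ h₂)
    · rintro (hs | hs)
      · rcases h₂ with rfl | h₂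
        · exact h₁' hs
        · exact ht _ _ _ (h₁' hs) h₂
      · rcases h₁ with rfl | h₁
        · exact h₂' hs
        · exact ht _ _ _ h₁ (h₂' hs)
  | .union e f, x, y, h => by
    rw [psemT] at h
    rw [PTrm.Strict]
    rcases h with h | h
    · have := psemT_eq_or_lt N hr ht e x y h
      exact ⟨this.1, fun hs => this.2 hs.1⟩
    · have := psemT_eq_or_lt N hr ht f x y h
      exact ⟨this.1, fun hs => this.2 hs.2⟩
  | .plus e, x, y, h => by
    rw [psemT] at h
    rw [PTrm.Strict]
    induction h with
    | single h => exact psemT_eq_or_lt N hr ht e _ _ h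
    | tail _ h ih =>
      have h' := psemT_eq_or_lt N hr ht e _ _ h
      refine ⟨?_, fun hs => ht _ _ _ (ih.2 hs) (h'.2 hs)⟩
      rcases ih.1 with rfl | h₁
      · exact h'.1
      · rcases h'.1 with rfl | h₂
        · exact .inr h₁
        · exact .inr (ht _ _ _ h₁ h₂)
  | .test φ, x, y, h => by
    rw [psemT] at h
    refine ⟨.inl h.1, fun hs => ?_⟩
    rw [PTrm.Strict] at hs
    subst hs
    simp [psemF] at h

/-! ### Fischer–Ladner closure -/

mutual
/-- The Fischer–Ladner closure of a formula. -/
def PFml.closure {VA VP : Type} : PFml VA VP → List (PFml VA VP)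
  | .pv p => [.pv p]
  | .imp φ ψ => .imp φ ψ :: (φ.closure ++ ψ.closure)
  | .fls => [.fls]
  | .box e φ => e.closure φ ++ φ.closure
/-- The formulas needed to analyse the box of a term applied to a formula. -/
def PTrm.closure {VA VP : Type} : PTrm VA VP → PFml VA VP → List (PFml VA VP)
  | .tv a, χ => [.box (.tv a) χ]
  | .comp e f, χ => .box (.comp e f) χ :: (e.closure (.box f χ) ++ f.closure χ)
  | .union e f, χ => .box (.union e f) χ :: (e.closure χ ++ f.closure χ)
  | .plus e, χ => .box (.plus e) χ :: (e.closure (.box (.plus e) χ) ++ e.closure χ)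
  | .test φ, χ => .box (.test φ) χ :: φ.closure
end

section Truth

set_option linter.unusedSectionVars false

variable {VA VP : Type}

theorem PTrm.box_mem_closure (e : PTrm VA VP) (χ : PFml VA VP) : .box e χ ∈ e.closure χ := by
  cases e <;> simp [PTrm.closure]

theorem PFml.mem_closure (φ : PFml VA VP) : φ ∈ φ.closure := by
  cases φ <;> simp [PFml.closure, PTrm.box_mem_closure]

theorem psemF_box_plus {W : Type} (M : GStruct VA VP W) (e : PTrm VA VP) (χ : PFml VA VP)
    (v : W) : psemF M (.box (.plus e) χ) v ↔
      psemF M (.box e χ) v ∧ psemF M (.box e (.box (.plus e) χ)) v := by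
  simp only [psemF, psemT]
  constructor
  · exact fun h => ⟨fun y hy => h y (.single hy), fun y hy z hz => h z (.head hy hz)⟩
  · rintro ⟨h₁, h₂⟩ y hy
    rcases Relation.TransGen.head'_iff.1 hy with ⟨z, hxz, hzy⟩
    rcases Relation.reflTransGen_iff_eq_or_transGen.1 hzy with rfl | h'
    · exact h₁ _ hxz
    · exact h₂ _ hxz _ h'

variable {W K : Type} (M : GStruct VA VP W) (N : GStruct VA VP K) (rep : K → W)
  (C : List (PFml VA VP)) (l : List VA) (r : K → K → Prop)
  (hval : ∀ p k, N.val p k ↔ M.val p (rep k))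
  (hbox : ∀ a ∈ l, ∀ χ ∈ C, ∀ k, psemF M (.box (.tv a) χ) (rep k) ↔
    ∀ k', N.rel a k k' → psemF M χ (rep k'))
  (hr : ∀ a x y, N.rel a x y → r x y) (ht : ∀ x y z, r x y → r y z → r x z)
  (hwf : WellFounded (fun y x => r x y))

include hval hbox hr ht hwf

mutual
theorem truthF : ∀ χ : PFml VA VP, χ.Guarded l → χ.closure ⊆ C → ∀ k,
    (psemF N χ k ↔ psemF M χ (rep k))
  | .pv p, _, _, k => by simp only [psemF, hval]
  | .imp φ ψ, hg, hC, k => by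
    rw [PFml.Guarded] at hg
    simp only [PFml.closure, List.cons_subset, List.append_subset] at hC
    simp only [psemF, truthF φ hg.1 hC.2.1 k, truthF ψ hg.2 hC.2.2 k]
  | .fls, _, _, k => by simp only [psemF]
  | .box e φ, hg, hC, k => by
    rw [PFml.Guarded] at hg
    simp only [PFml.closure, List.append_subset] at hC
    rw [truthT e φ hg.1 hC.1 (hC.2 φ.mem_closure) k, psemF]
    simp only [truthF φ hg.2 hC.2]
theorem truthT : ∀ (e : PTrm VA VP) (χ : PFml VA VP), e.Guarded l → e.closure χ ⊆ C → χ ∈ C →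
    ∀ k, (psemF M (.box e χ) (rep k) ↔ ∀ k', psemT N e k k' → psemF M χ (rep k'))
  | .tv a, χ, hg, hC, hχ, k => by
    rw [PTrm.Guarded] at hg
    rw [hbox a hg χ hχ k]
    simp only [psemT]
  | .comp e f, χ, hg, hC, hχ, k => by
    rw [PTrm.Guarded] at hg
    simp only [PTrm.closure, List.cons_subset, List.append_subset] at hC
    have he := truthT e (.box f χ) hg.1 hC.2.1 (hC.2.2 (f.box_mem_closure χ)) k
    have hf := truthT f χ hg.2 hC.2.2 hχ
    have : psemF M (.box (.comp e f) χ) (rep k) ↔ psemF M (.box e (.box f χ)) (rep k) := by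
      simp only [psemF, psemT]
      exact ⟨fun h y hy z hz => h z ⟨y, hy, hz⟩, fun h z ⟨y, hy, hz⟩ => h y hy z hz⟩
    rw [this, he]
    simp only [hf, psemT]
    exact ⟨fun h z ⟨y, hy, hz⟩ => h y hy z hz, fun h y hy z hz => h z ⟨y, hy, hz⟩⟩
  | .union e f, χ, hg, hC, hχ, k => by
    rw [PTrm.Guarded] at hg
    simp only [PTrm.closure, List.cons_subset, List.append_subset] at hC
    have he := truthT e χ hg.1 hC.2.1 hχ k
    have hf := truthT f χ hg.2 hC.2.2 hχ k
    have : psemF M (.box (.union e f) χ) (rep k) ↔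
        psemF M (.box e χ) (rep k) ∧ psemF M (.box f χ) (rep k) := by
      simp only [psemF, psemT, or_imp, forall_and]
    rw [this, he, hf]
    simp only [psemT, or_imp, forall_and]
  | .plus e, χ, hg, hC, hχ, k => by
    rw [PTrm.Guarded] at hg
    simp only [PTrm.closure, List.cons_subset, List.append_subset] at hC
    have h₁ := truthT e χ hg.1 hC.2.2 hχ
    have h₂ := truthT e (.box (.plus e) χ) hg.1 hC.2.1 hC.1
    simp only [psemT]
    constructor
    · intro h k' hk'
      have step : ∀ x y, psemF M (.box (.plus e) χ) (rep x) → psemT N e x y →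
          psemF M χ (rep y) ∧ psemF M (.box (.plus e) χ) (rep y) := by
        intro x y hx hxy
        have hx := (psemF_box_plus M e χ _).1 hx
        exact ⟨(h₁ x).1 hx.1 y hxy, (h₂ x).1 hx.2 y hxy⟩
      suffices psemF M χ (rep k') ∧ psemF M (.box (.plus e) χ) (rep k') from this.1
      induction hk' with
      | single hy => exact step _ _ h hy
      | tail _ hy ih => exact step _ _ ih.2 hy
    · induction k using hwf.induction with
      | _ k ih =>
        intro h
        refine (psemF_box_plus M e χ _).2 ⟨(h₁ k).2 fun k' hk' => h k' (.single hk'),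
          (h₂ k).2 fun k' hk' => ?_⟩
        exact ih k' ((psemT_eq_or_lt N hr ht e k k' hk').2 hg.2)
          fun k'' hk'' => h k'' (.head hk' hk'')
  | .test φ, χ, hg, hC, hχ, k => by
    rw [PTrm.Guarded] at hg
    simp only [PTrm.closure, List.cons_subset] at hC
    have hφ := truthF φ hg hC.2 k
    have aux : ∀ {X : Type} (Q : X → Prop) (x : X) (p : Prop),
        (∀ y, x = y ∧ p → Q y) ↔ (p → Q x) :=
      fun Q x p => ⟨fun h hp => h x ⟨rfl, hp⟩, fun h y hy => hy.1 ▸ h hy.2⟩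
    simp only [psemF, psemT]
    rw [aux, aux (fun k' => psemF M χ (rep k')), hφ]
end

end Truth

/-! ### Löb instances suffice -/

section Loeb

variable {VA VP : Type}

/-- The union of the term variables in a list. -/
def PTrm.sum : List VA → PTrm VA VP
  | [] => .test .fls
  | a :: l => .union (.tv a) (sum l)

/-- The Löb principle for the transitive closure of a term. -/
def PFml.loeb (u : PTrm VA VP) (χ : PFml VA VP) : PFml VA VP :=
  .imp (.box (.plus u) (.imp (.box (.plus u) χ) χ)) (.box (.plus u) χ)

/-- Negations of the descriptions of all types over a list of formulas. -/
def cotypes : List (PFml VA VP) → List (PFml VA VP)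
  | [] => [.fls]
  | c :: C => (cotypes C).map (.imp c) ++ (cotypes C).map (.imp c.neg)

theorem psemT_sum {W : Type} (M : GStruct VA VP W) {l : List VA} {a : VA} (ha : a ∈ l) {x y : W}
    (h : M.rel a x y) : psemT M (PTrm.sum l) x y := by
  induction l with
  | nil => simp at ha
  | cons b l ih =>
    simp only [PTrm.sum, psemT]
    rcases List.mem_cons.1 ha with rfl | ha
    · exact .inl h
    · exact .inr (ih ha)

theorem exists_cotype {W : Type} (M : GStruct VA VP W) (C : List (PFml VA VP)) (v : W) :
    ∃ τ ∈ cotypes C, ∀ t, ¬ psemF M τ t ↔ ∀ χ ∈ C, (psemF M χ t ↔ psemF M χ v) := by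
  induction C with
  | nil => exact ⟨.fls, by simp [cotypes], by simp [psemF]⟩
  | cons c C ih =>
    obtain ⟨τ, hτ, h⟩ := ih
    by_cases hc : psemF M c v
    · refine ⟨.imp c τ, by simp [cotypes, hτ], fun t => ?_⟩
      simp [psemF, h, hc]
    · refine ⟨.imp c.neg τ, by simp [cotypes, hτ], fun t => ?_⟩
      simp [psemF, PFml.neg, h, hc]

theorem psemF_foldr_imp {W : Type} (M : GStruct VA VP W) (L : List (PFml VA VP))
    (ψ : PFml VA VP) (x : W) :
    psemF M (L.foldr .imp ψ) x ↔ ((∀ χ ∈ L, psemF M χ x) → psemF M ψ x) := by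
  induction L with
  | nil => simp
  | cons c L ih => simp [psemF, ih]

/-- The Löb instances, and their boxes, for the types over a list of formulas. -/
def loebList (u : PTrm VA VP) (C : List (PFml VA VP)) : List (PFml VA VP) :=
  (cotypes C).map (.loeb u) ++ (cotypes C).map fun τ => .box (.plus u) (.loeb u τ)

theorem valid_of_valid_linear (l : List VA) (ψ : PFml VA VP) (hg : ψ.Guarded l)
    (hψ : ∀ (K : Type) (_ : Finite K) (s : K → K → Prop) (_ : IsLinearOrder K s)
      (rel : VA → K → K → Prop) (val : VP → K → Prop),
      (∀ a x y, rel a x y → s x y ∧ x ≠ y) → ∀ x, psemF (.free rel val) ψ x) :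
    PValidREL ((loebList (.sum l) ψ.closure).foldr .imp ψ) := by
  intro W M _ _ w
  rw [psemF_foldr_imp]
  intro hL
  set C := ψ.closure
  set u : PTrm VA VP := .sum l
  let R : W → W → Prop := Relation.TransGen (psemT M u)
  let Good : W → Prop := fun v => ∀ τ ∈ cotypes C,
    psemF M (.loeb u τ) v ∧ ∀ t, R v t → psemF M (.loeb u τ) t
  have good_step : ∀ v t, Good v → R v t → Good t := fun v t hv ht τ hτ =>
    ⟨(hv τ hτ).2 t ht, fun s hs => (hv τ hτ).2 s (ht.trans hs)⟩
  have good_w : Good w := by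
    intro τ hτ
    refine ⟨hL _ (List.mem_append_left _ (List.mem_map_of_mem hτ)), ?_⟩
    have : psemF M (.box (.plus u) (.loeb u τ)) w :=
      hL _ (List.mem_append_right _
        (List.mem_map_of_mem (f := fun τ => PFml.box (.plus u) (.loeb u τ)) hτ))
    rw [psemF] at this
    exact fun t ht => this t (by rw [psemT]; exact ht)
  let tp : W → Set (PFml VA VP) := fun v => {χ | χ ∈ C ∧ psemF M χ v}
  let above : W → Set (Set (PFml VA VP)) := fun v => {X | ∃ t, R v t ∧ tp t = X}
  have tp_eq : ∀ v t, tp v = tp t ↔ ∀ χ ∈ C, (psemF M χ v ↔ psemF M χ t) := by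
    intro v t
    simp only [tp, Set.ext_iff, Set.mem_ofPred_eq]
    exact forall_congr' fun χ => by tauto
  have exists_max : ∀ t, Good t → ∃ v, Good v ∧ (v = t ∨ R t v) ∧ tp v = tp t ∧
      tp v ∉ above v := by
    intro t hgt
    by_cases hmax : tp t ∈ above t
    · obtain ⟨τ, hτ, h⟩ := exists_cotype M C t
      have hl := (hgt τ hτ).1
      simp only [PFml.loeb, psemF, psemT] at hl
      obtain ⟨s, hs, hst⟩ := hmax
      by_contra hcon
      refine (h s).2 ((tp_eq s t).1 hst) (hl ?_ s hs)
      intro v hv hvτ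
      by_contra hn
      have hvt := (tp_eq v t).2 ((h v).1 hn)
      refine hcon ⟨v, good_step t v hgt hv, .inr hv, hvt, ?_⟩
      rintro ⟨z, hz, hzv⟩
      exact (h z).2 ((tp_eq z t).1 (hzv.trans hvt)) (hvτ z hz)
    · exact ⟨t, hgt, .inl rfl, rfl, hmax⟩
  let keys : Set (Set (PFml VA VP) × Set (Set (PFml VA VP))) :=
    {k | ∃ v, Good v ∧ tp v ∉ above v ∧ (tp v, above v) = k}
  have keys_fin : keys.Finite := by
    have hCf : {χ | χ ∈ C}.Finite := C.finite_toSet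
    refine (hCf.powerset.prod hCf.powerset.powerset).subset ?_
    rintro _ ⟨v, -, -, rfl⟩
    refine ⟨fun χ h => h.1, ?_⟩
    rintro _ ⟨t, -, rfl⟩
    exact fun χ h => h.1
  have keys_finite : Finite keys := keys_fin
  choose rep rep_good rep_max rep_key using fun k : keys => k.2
  have rep_tp : ∀ k : keys, tp (rep k) = k.1.1 := fun k => congrArg Prod.fst (rep_key k)
  have rep_above : ∀ k : keys, above (rep k) = k.1.2 := fun k => congrArg Prod.snd (rep_key k)
  let r : keys → keys → Prop := fun k k' => k'.1.2 ⊂ k.1.2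
  let N : GStruct VA VP keys := .free
    (fun a k k' => r k k' ∧ ∃ t, M.rel a (rep k) t ∧ tp t = k'.1.1)
    (fun p k => M.val p (rep k))
  have htr : ∀ x y z, r x y → r y z → r x z := fun x y z h₁ h₂ => h₂.trans h₁
  have hwf : WellFounded (fun y x => r x y) := by
    have : Std.Irrefl (fun y x : keys => r x y) := ⟨fun x h => ssubset_irrefl _ h⟩
    have : IsTrans keys (fun y x : keys => r x y) := ⟨fun _ _ _ h₁ h₂ => h₁.trans h₂⟩
    exact Finite.wellFounded_of_trans_of_irrefl _
  have hbox : ∀ a ∈ l, ∀ χ ∈ C, ∀ k, psemF M (.box (.tv a) χ) (rep k) ↔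
      ∀ k', N.rel a k k' → psemF M χ (rep k') := by
    intro a ha χ hχ k
    simp only [psemF, psemT]
    constructor
    · rintro h k' ⟨-, t, ht, htk⟩
      exact ((tp_eq _ _).1 (htk.trans (rep_tp k').symm) χ hχ).1 (h t ht)
    · intro h t ht
      have hkt : R (rep k) t := .single (psemT_sum M ha ht)
      obtain ⟨v, hgv, hvt, htp, hmax⟩ := exists_max t (good_step _ _ (rep_good k) hkt)
      have hkv : R (rep k) v := by
        rcases hvt with rfl | hvt
        · exact hkt
        · exact hkt.trans hvt
      let k' : keys := ⟨(tp v, above v), v, hgv, hmax, rfl⟩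
      have hrk : r k k' := by
        change above v ⊂ k.1.2
        rw [← rep_above k]
        refine ⟨fun X ⟨s, hs, hX⟩ => ⟨s, hkv.trans hs, hX⟩, fun hsub => ?_⟩
        exact hmax (hsub ⟨v, hkv, rfl⟩)
      have hk' := h k' ⟨hrk, t, ht, htp.symm⟩
      exact ((tp_eq _ _).1 ((rep_tp k').trans htp) χ hχ).1 hk'
  have truth := truthF M N rep C l r (fun _ _ => Iff.rfl) hbox (fun _ _ _ h => h.1) htr hwf ψ hg
    (List.Subset.refl _)
  obtain ⟨v, hgv, -, htp, hmax⟩ := exists_max w good_w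
  let k₀ : keys := ⟨(tp v, above v), v, hgv, hmax, rfl⟩
  let le : keys → keys → Prop := fun x y => x = y ∨ r x y
  have : IsPartialOrder keys le :=
    { refl := fun x => .inl rfl
      trans := by
        rintro x y z (rfl | h₁) (rfl | h₂)
        · exact .inl rfl
        · exact .inr h₂
        · exact .inr h₁
        · exact .inr (htr _ _ _ h₁ h₂)
      antisymm := by
        rintro x y (rfl | h₁) (h | h₂)
        · rfl
        · rfl
        · exact h.symm
        · exact absurd (htr _ _ _ h₁ h₂) (ssubset_irrefl _) }
  obtain ⟨s, hs, hle⟩ := extend_partialOrder le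
  have hk₀ : psemF N ψ k₀ := by
    refine hψ keys keys_finite s hs _ _ ?_ k₀
    rintro a x y ⟨hxy, -⟩
    refine ⟨hle _ _ (.inr hxy), ?_⟩
    rintro rfl
    exact ssubset_irrefl _ hxy
  have := (truth k₀).1 hk₀
  exact ((tp_eq _ _).1 ((rep_tp k₀).trans htp) ψ ψ.mem_closure).1 this

end Loeb

/-! ### Completeness -/

/-- The union of the term variables in a list. -/
def Trm.sum {A P : Type} : List A → Trm A P
  | [] => .test .fls
  | a :: l => .union (.tv a) (sum l)

theorem Trm.strictT_sum {A P : Type} (l : List A) :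
    (Trm.sum l : Trm A P).strictT = PTrm.sum l := by
  induction l with
  | nil => simp only [Trm.sum, Trm.strictT, PTrm.sum]
  | cons a l ih => simp only [Trm.sum, Trm.strictT, PTrm.sum, ih]

theorem HProof.inst_loeb {A P : Type} (l : List A) (χ : PFml A (P ⊕ A)) :
    HProof (instF backT backF (.loeb (.sum l) χ)) := by
  have h := (capNid_equiv (Trm.sum l : Trm A P)).plus
  rw [Trm.strictT_sum] at h
  set θ : Fml A P := instF backT backF χ with hθ
  simp only [PFml.loeb, instF, instT, ← hθ]
  have h₁ := h.symm.box (φ := .imp (.box (instT backT backF (.sum l)).plus θ) θ)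
    ⟨.imp_congr (h.1 θ) (.imp_refl _), .imp_congr (h.2 θ) (.imp_refl _)⟩
  exact h₁.1.imp_trans ((HProof.loeb (Trm.sum l) θ).imp_trans (h.1 θ))

theorem HProof.of_foldr_imp {A P VA VP : Type} {σt : VA → Trm A P} {σf : VP → Fml A P}
    {L : List (PFml VA VP)} {ψ : PFml VA VP} (hL : ∀ χ ∈ L, HProof (instF σt σf χ))
    (h : HProof (instF σt σf (L.foldr .imp ψ))) : HProof (instF σt σf ψ) := by
  induction L with
  | nil => exact h
  | cons c L ih =>
    simp only [List.foldr_cons, instF] at h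
    exact ih (fun χ hχ => hL χ (.tail _ hχ)) ((hL c (.head _)).mp h)

/-- The linear structure in which `a` is interpreted by `rel a` together with the loops
given by `.inr a`. -/
def GStruct.withLoops {A P K : Type} (s : K → K → Prop) (hs : IsLinearOrder K s)
    (rel : A → K → K → Prop) (val : P ⊕ A → K → Prop)
    (hrel : ∀ a x y, rel a x y → s x y ∧ x ≠ y) : GStruct A P K where
  U := s
  rel a x y := rel a x y ∨ (x = y ∧ val (.inr a) x)
  rel_sub a x y h := h.elim (fun h => (hrel a x y h).1) (fun h => h.1 ▸ refl_of s x)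
  val p := val (.inl p)

theorem GStruct.withLoops_pull {A P K : Type} (s : K → K → Prop) (hs : IsLinearOrder K s)
    (rel : A → K → K → Prop) (val : P ⊕ A → K → Prop)
    (hrel : ∀ a x y, rel a x y → s x y ∧ x ≠ y) :
    (GStruct.withLoops s hs rel val hrel).pull backT backF = .free rel val := by
  unfold GStruct.pull
  congr 1
  · funext a x y
    simp only [backT, semT, withLoops, eq_iff_iff]
    have := hrel a x y
    tauto
  · funext p x
    rcases p with p | a
    · simp only [backF, semF, withLoops]
    · simp only [backF, semF, semT, withLoops, Fml.dia, Fml.tru, Fml.neg, eq_iff_iff]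
      constructor
      · intro h
        by_contra hn
        refine h fun y ⟨hy, hxy⟩ => ?_
        subst hxy
        exact absurd hy (by have := hrel a x x; tauto)
      · exact fun h h' => h' x ⟨.inr ⟨rfl, h⟩, rfl⟩ id

theorem pdl_rewla_completeness {A P : Type} (φ : Fml A P) :
    (∀ (W : Type) (S : GStruct A P W), FinLin S → ∀ x : W, semF S φ x) ↔ HProof φ := by
  refine ⟨fun h => ?_, fun h W S hS => h.sound S hS⟩
  have hφ := toPDL_equiv φ
  refine HProof.mp (HProof.of_foldr_imp ?_ (.pdl _ (valid_of_valid_linear φ.vars φ.toPDL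
    (toPDL_guarded _ φ (List.Subset.refl _)) ?_) backT backF)) hφ.2
  · intro χ hχ
    simp only [loebList, List.mem_append, List.mem_map] at hχ
    rcases hχ with ⟨τ, -, rfl⟩ | ⟨τ, -, rfl⟩
    · exact .inst_loeb _ τ
    · rw [instF]
      exact (HProof.inst_loeb _ τ).nec _
  · intro K hK s hs rel val hrel x
    have hlin : FinLin (GStruct.withLoops s hs rel val hrel) :=
      ⟨⟨x⟩, hK, refl_of s, fun _ _ _ => trans_of s, fun _ _ => antisymm_of s, total_of s⟩
    have hx := hφ.1.sound _ hlin x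
    rw [semF] at hx
    rw [← GStruct.withLoops_pull s hs rel val hrel, ← semF_inst]
    exact hx (h K _ hlin x)
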